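/- arXiv:1706.09616 — 3 statements merged into one kernel-verified Lean document; each statement's English description precedes it below -/
import Mathlib

section
/- Let L₁, L be real numbers with 0 < L₁ ≤ L/2 and suppose L₁/L is irrational. Then for each sign ε ∈ {+1, −1}, the set of pairs (ω, u), where ω < 0 and u : ℝ → ℝ is a twice continuously differentiable L-periodic function satisfying −u''(x) − u(x)³ = ω·u(x) for all x ∈ ℝ, u(0) = √(2|ω|) and u(L₁) = ε·√(2|ω|), is countable. -/
open Real Filter Set

/-- Two global integral curves of a `C¹` autonomous vector field that agree at `0` coincide. -/
theorem integralCurve_unique {E : Type*} [NormedAddCommGroup E] [NormedSpace ℝ E] [ProperSpace E]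
    {v : E → E} (hv : ContDiff ℝ 1 v) {f g : ℝ → E} (hf : ∀ t, HasDerivAt f (v (f t)) t)
    (hg : ∀ t, HasDerivAt g (v (g t)) t) (h0 : f 0 = g 0) : f = g := by
  ext1 t
  have hfc : Continuous f := continuous_iff_continuousAt.2 fun t => (hf t).continuousAt
  have hgc : Continuous g := continuous_iff_continuousAt.2 fun t => (hg t).continuousAt
  set r := |t| + 1
  have ht : t ∈ Ioo (-r) r := abs_lt.1 (lt_add_one |t|)
  have h0r : (0 : ℝ) ∈ Ioo (-r) r := by
    have : 0 < r := by positivity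
    exact ⟨by linarith, this⟩
  obtain ⟨R, hR⟩ := (((isCompact_Icc (a := -r) (b := r)).image hfc).union
    ((isCompact_Icc (a := -r) (b := r)).image hgc)).isBounded.subset_closedBall 0
  obtain ⟨K, hK⟩ := ContDiffOn.exists_lipschitzOnWith (s := Metric.closedBall (0 : E) R)
    hv.contDiffOn one_ne_zero (convex_closedBall 0 R) (isCompact_closedBall 0 R)
  exact ODE_solution_unique_of_mem_Ioo (v := fun _ => v) (fun _ _ => hK) h0r
    (fun s hs => ⟨hf s, hR (Or.inl ⟨s, Ioo_subset_Icc_self hs, rfl⟩)⟩)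
    (fun s hs => ⟨hg s, hR (Or.inr ⟨s, Ioo_subset_Icc_self hs, rfl⟩)⟩) h0 ht

/-- Uniqueness for the second-order equation with force `-ω u - u³`. -/
theorem duffing_unique {ω : ℝ} {u p v q : ℝ → ℝ} (hu : ∀ x, HasDerivAt u (p x) x)
    (hp : ∀ x, HasDerivAt p (-ω * u x - u x ^ 3) x) (hv : ∀ x, HasDerivAt v (q x) x)
    (hq : ∀ x, HasDerivAt q (-ω * v x - v x ^ 3) x) (h0 : u 0 = v 0) (h1 : p 0 = q 0) :
    u = v := by
  have hF : ContDiff ℝ 1 (fun z : ℝ × ℝ => (z.2, -ω * z.1 - z.1 ^ 3)) := by fun_prop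
  have := integralCurve_unique hF (f := fun x => (u x, p x)) (g := fun x => (v x, q x))
    (fun x => (hu x).prodMk (hp x)) (fun x => (hv x).prodMk (hq x)) (by simp [h0, h1])
  ext x
  exact congrArg Prod.fst (congrFun this x)

/-- The integrand `1 / √(cos² φ + sin² α)`. -/
noncomputable def phaseDensity (α φ : ℝ) : ℝ := (√(cos φ ^ 2 + sin α ^ 2))⁻¹

/-- The time `∫₀^θ dφ / √(cos² φ + sin² α)` at which the phase `θ` is reached. -/
noncomputable def phaseTime (α θ : ℝ) : ℝ := ∫ φ in (0 : ℝ)..θ, phaseDensity α φ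

/-- The phase as a function of time. -/
noncomputable def phase (α : ℝ) : ℝ → ℝ := Function.invFun (phaseTime α)

section Phase

variable {α : ℝ}

theorem cos_sq_add_sin_sq_pos (hα : sin α ≠ 0) (φ : ℝ) : 0 < cos φ ^ 2 + sin α ^ 2 := by
  positivity

theorem phaseDensity_pos (hα : sin α ≠ 0) (φ : ℝ) : 0 < phaseDensity α φ :=
  inv_pos.2 (sqrt_pos.2 (cos_sq_add_sin_sq_pos hα φ))

theorem continuous_phaseDensity (hα : sin α ≠ 0) : Continuous (phaseDensity α) := by
  unfold phaseDensity
  exact Continuous.inv₀ (by fun_prop) fun φ => (sqrt_pos.2 (cos_sq_add_sin_sq_pos hα φ)).ne'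

theorem phaseDensity_periodic (α : ℝ) : Function.Periodic (phaseDensity α) π := by
  intro φ
  simp [phaseDensity, cos_add_pi]

theorem hasDerivAt_phaseTime (hα : sin α ≠ 0) (θ : ℝ) :
    HasDerivAt (phaseTime α) (phaseDensity α θ) θ :=
  (continuous_phaseDensity hα).integral_hasStrictDerivAt 0 θ |>.hasDerivAt

theorem strictMono_phaseTime (hα : sin α ≠ 0) : StrictMono (phaseTime α) :=
  strictMono_of_hasDerivAt_pos (hasDerivAt_phaseTime hα) (phaseDensity_pos hα)

theorem phaseTime_zero (α : ℝ) : phaseTime α 0 = 0 := by simp [phaseTime]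

theorem phaseTime_neg (α θ : ℝ) : phaseTime α (-θ) = -phaseTime α θ := by
  have h := intervalIntegral.integral_comp_neg (phaseDensity α) (a := 0) (b := θ)
  have h2 : ∀ φ, phaseDensity α (-φ) = phaseDensity α φ := by simp [phaseDensity]
  simp only [h2, neg_zero] at h
  rw [phaseTime, phaseTime, h, intervalIntegral.integral_symm]

theorem phaseTime_neg_left (α θ : ℝ) : phaseTime (-α) θ = phaseTime α θ := by
  simp [phaseTime, phaseDensity]

theorem phaseTime_add_int_mul_pi (hα : sin α ≠ 0) (θ : ℝ) (n : ℤ) :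
    phaseTime α (θ + n * π) = phaseTime α θ + n * phaseTime α π := by
  have hi : ∀ a b, IntervalIntegrable (phaseDensity α) MeasureTheory.volume a b :=
    fun a b => (continuous_phaseDensity hα).intervalIntegrable a b
  have h := (phaseDensity_periodic α).intervalIntegral_add_zsmul_eq n θ hi
  rw [(phaseDensity_periodic α).intervalIntegral_add_eq θ 0, zero_add, zsmul_eq_mul,
    zsmul_eq_mul] at h
  rw [phaseTime, phaseTime, phaseTime, ← h,
    intervalIntegral.integral_add_adjacent_intervals (hi _ _) (hi _ _)]

theorem phaseTime_pi (hα : sin α ≠ 0) : phaseTime α π = 2 * phaseTime α (π / 2) := by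
  have h := phaseTime_add_int_mul_pi hα (-(π / 2)) 1
  rw [phaseTime_neg] at h
  have : -(π / 2) + ((1 : ℤ) : ℝ) * π = π / 2 := by push_cast; ring
  rw [this] at h
  push_cast at h
  linarith

theorem phaseTime_pi_pos (hα : sin α ≠ 0) : 0 < phaseTime α π := by
  simpa [phaseTime_zero] using strictMono_phaseTime hα pi_pos

theorem surjective_phaseTime (hα : sin α ≠ 0) : Function.Surjective (phaseTime α) := by
  have hc : Continuous (phaseTime α) :=
    continuous_iff_continuousAt.2 fun θ => (hasDerivAt_phaseTime hα θ).continuousAt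
  intro y
  have hpos := phaseTime_pi_pos hα
  have key : ∀ n : ℤ, phaseTime α (n * π) = n * phaseTime α π := fun n => by
    simpa [phaseTime_zero] using phaseTime_add_int_mul_pi hα 0 n
  have h1 : phaseTime α (⌊y / phaseTime α π⌋ * π) ≤ y := by
    rw [key, ← le_div_iff₀ hpos]
    exact Int.floor_le _
  have h2 : y ≤ phaseTime α (⌈y / phaseTime α π⌉ * π) := by
    rw [key, ← div_le_iff₀ hpos]
    exact Int.le_ceil _
  exact mem_range_of_exists_le_of_exists_ge hc ⟨_, h1⟩ ⟨_, h2⟩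

theorem phaseTime_phase (hα : sin α ≠ 0) (t : ℝ) : phaseTime α (phase α t) = t :=
  Function.invFun_eq (surjective_phaseTime hα t)

theorem phase_phaseTime (hα : sin α ≠ 0) (θ : ℝ) : phase α (phaseTime α θ) = θ :=
  Function.leftInverse_invFun (strictMono_phaseTime hα).injective θ

theorem hasDerivAt_phase (hα : sin α ≠ 0) (t : ℝ) :
    HasDerivAt (phase α) (√(cos (phase α t) ^ 2 + sin α ^ 2)) t := by
  have hc : Continuous (phase α) := by
    refine Monotone.continuous_of_surjective (fun s t hst => ?_) fun θ => ⟨_, phase_phaseTime hα θ⟩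
    rwa [← (strictMono_phaseTime hα).le_iff_le, phaseTime_phase hα, phaseTime_phase hα]
  have h := HasDerivAt.of_local_left_inverse hc.continuousAt
    (hasDerivAt_phaseTime hα (phase α t)) (phaseDensity_pos hα _).ne'
    (Eventually.of_forall (phaseTime_phase hα))
  simpa [phaseDensity] using h

end Phase

theorem phaseDensity_mul_le {α β φ ψ : ℝ} (hα : sin α ≠ 0) (hβ : sin β ≠ 0)
    (hαβ : sin α ^ 2 ≤ sin β ^ 2) (hφψ : cos ψ ^ 2 ≤ cos φ ^ 2) :
    phaseDensity β ψ * phaseDensity α φ ≤ phaseDensity β φ * phaseDensity α ψ := by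
  have h1 := cos_sq_add_sin_sq_pos hα φ
  have h2 := cos_sq_add_sin_sq_pos hα ψ
  have h3 := cos_sq_add_sin_sq_pos hβ φ
  have h4 := cos_sq_add_sin_sq_pos hβ ψ
  unfold phaseDensity
  rw [← mul_inv, ← mul_inv, ← sqrt_mul h4.le, ← sqrt_mul h3.le]
  refine inv_anti₀ (sqrt_pos.2 (mul_pos h3 h2)) (sqrt_le_sqrt ?_)
  nlinarith [mul_nonneg (sub_nonneg.2 hαβ) (sub_nonneg.2 hφψ)]

theorem phaseTime_ratio_lt {α β : ℝ} (hα : 0 < α) (hαβ : α < β) (hβ : β < π / 2) :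
    phaseTime α α * phaseTime β π < phaseTime β β * phaseTime α π := by
  have hsα : 0 < sin α := sin_pos_of_pos_of_lt_pi hα (by linarith)
  have hsαβ : sin α < sin β := sin_lt_sin_of_lt_of_le_pi_div_two (by linarith) hβ.le hαβ
  have hsβ : 0 < sin β := hsα.trans hsαβ
  have hsq : sin α ^ 2 ≤ sin β ^ 2 := by gcongr
  have hi : ∀ {γ : ℝ}, sin γ ≠ 0 → ∀ a b,
      IntervalIntegrable (phaseDensity γ) MeasureTheory.volume a b :=
    fun h a b => (continuous_phaseDensity h).intervalIntegrable a b
  have hsplit : ∀ {γ : ℝ}, sin γ ≠ 0 → ∀ a b,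
      phaseTime γ a + ∫ φ in a..b, phaseDensity γ φ = phaseTime γ b := fun h a b =>
    intervalIntegral.integral_add_adjacent_intervals (hi h _ _) (hi h _ _)
  have hlow : phaseDensity β α * phaseTime α α ≤ phaseDensity α α * phaseTime β α := by
    unfold phaseTime
    rw [← intervalIntegral.integral_const_mul, ← intervalIntegral.integral_const_mul]
    refine intervalIntegral.integral_mono_on hα.le ((hi hsα.ne' _ _).const_mul _)
      ((hi hsβ.ne' _ _).const_mul _) fun φ hφ => ?_
    have hc : cos α ^ 2 ≤ cos φ ^ 2 := by
      have := cos_le_cos_of_nonneg_of_le_pi hφ.1 (by linarith) hφ.2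
      have := cos_nonneg_of_neg_pi_div_two_le_of_le (x := α) (by linarith) (by linarith)
      gcongr
    linarith [phaseDensity_mul_le hsα.ne' hsβ.ne' hsq hc]
  have hhigh : phaseDensity α α * ∫ φ in α..(π / 2), phaseDensity β φ ≤
      phaseDensity β α * ∫ φ in α..(π / 2), phaseDensity α φ := by
    rw [← intervalIntegral.integral_const_mul, ← intervalIntegral.integral_const_mul]
    refine intervalIntegral.integral_mono_on (by linarith) ((hi hsβ.ne' _ _).const_mul _)
      ((hi hsα.ne' _ _).const_mul _) fun φ hφ => ?_
    have hc : cos φ ^ 2 ≤ cos α ^ 2 := by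
      have := cos_le_cos_of_nonneg_of_le_pi hα.le (by linarith [hφ.2]) hφ.1
      have := cos_nonneg_of_neg_pi_div_two_le_of_le (x := φ) (by linarith [hφ.1]) hφ.2
      gcongr
    linarith [phaseDensity_mul_le hsα.ne' hsβ.ne' hsq hc]
  have e1 := hsplit hsα.ne' α (π / 2)
  have e2 := hsplit hsβ.ne' α (π / 2)
  have m1 : phaseTime β α < phaseTime β β := strictMono_phaseTime hsβ.ne' hαβ
  have m2 : 0 < phaseTime α α := by
    simpa [phaseTime_zero] using strictMono_phaseTime hsα.ne' hα
  have m3 : phaseTime α α < phaseTime α (π / 2) := strictMono_phaseTime hsα.ne' (by linarith)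
  have d1 := phaseDensity_pos hsα.ne' α
  rw [phaseTime_pi hsα.ne', phaseTime_pi hsβ.ne', ← e1, ← e2]
  rw [← e1] at m3
  set A := phaseTime α α
  set C := ∫ φ in α..(π / 2), phaseDensity α φ
  set B := phaseTime β α
  set D := ∫ φ in α..(π / 2), phaseDensity β φ
  have hC : 0 < C := by linarith
  have hAD : A * D ≤ B * C := by
    refine le_of_mul_le_mul_left ?_ d1
    calc phaseDensity α α * (A * D) = A * (phaseDensity α α * D) := by ring
      _ ≤ A * (phaseDensity β α * C) := by gcongr
      _ = (phaseDensity β α * A) * C := by ring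
      _ ≤ (phaseDensity α α * B) * C := by gcongr
      _ = _ := by ring
  nlinarith [mul_pos (sub_pos.2 m1) (add_pos m2 hC)]

theorem sin_ne_zero_of_mem_Ioo {α : ℝ} (h : α ∈ Ioo (-(π / 2)) (π / 2)) (h0 : α ≠ 0) :
    sin α ≠ 0 := by
  intro hs
  exact h0 ((sin_eq_zero_iff_of_lt_of_lt (by linarith [h.1, pi_pos]) (by linarith [h.2, pi_pos])).1
    hs)

theorem phaseTime_ratio_injective {α β : ℝ} (hα : α ∈ Ioo (-(π / 2)) (π / 2)) (hα0 : α ≠ 0)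
    (hβ : β ∈ Ioo (-(π / 2)) (π / 2)) (hβ0 : β ≠ 0)
    (h : phaseTime α α * phaseTime β π = phaseTime β β * phaseTime α π) : α = β := by
  have hsα := sin_ne_zero_of_mem_Ioo hα hα0
  have hsβ := sin_ne_zero_of_mem_Ioo hβ hβ0
  have pα := phaseTime_pi_pos hsα
  have pβ := phaseTime_pi_pos hsβ
  have mα := strictMono_phaseTime hsα
  have mβ := strictMono_phaseTime hsβ
  rcases lt_or_gt_of_ne hα0 with ha | ha <;> rcases lt_or_gt_of_ne hβ0 with hb | hb
  · have key : ∀ {γ δ : ℝ}, -(π / 2) < γ → γ < δ → δ < 0 →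
        phaseTime γ γ * phaseTime δ π < phaseTime δ δ * phaseTime γ π := by
      intro γ δ h1 h2 h3
      have := phaseTime_ratio_lt (α := -δ) (β := -γ) (by linarith) (by linarith) (by linarith)
      simp only [phaseTime_neg_left, phaseTime_neg] at this
      linarith
    rcases lt_trichotomy α β with hl | hl | hl
    · exact absurd h (key hα.1 hl hb).ne
    · exact hl
    · exact absurd h (key hβ.1 hl ha).ne'
  · have h1 := mα ha
    have h2 := mβ hb
    rw [phaseTime_zero] at h1 h2
    nlinarith [mul_pos h2 pα, mul_pos (neg_pos.2 h1) pβ]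
  · have h1 := mα ha
    have h2 := mβ hb
    rw [phaseTime_zero] at h1 h2
    nlinarith [mul_pos (neg_pos.2 h2) pα, mul_pos h1 pβ]
  · rcases lt_trichotomy α β with hl | hl | hl
    · exact absurd h (phaseTime_ratio_lt ha hl hβ.2).ne
    · exact hl
    · exact absurd h (phaseTime_ratio_lt hb hl hα.2).ne'

/-- The sign-changing periodic solution for `ω = -(l cos α)²` with amplitude `√2 l`,
started at the phase `α`. -/
noncomputable def cnWave (α l x : ℝ) : ℝ := √2 * l * cos (phase α (l * x + phaseTime α α))

/-- The derivative of `cnWave α l`. -/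
noncomputable def cnWaveDeriv (α l x : ℝ) : ℝ :=
  -(√2 * l ^ 2) * (sin (phase α (l * x + phaseTime α α)) *
    √(cos (phase α (l * x + phaseTime α α)) ^ 2 + sin α ^ 2))

section Wave

variable {α : ℝ}

theorem hasDerivAt_phase_affine (hα : sin α ≠ 0) (l x : ℝ) :
    HasDerivAt (fun x => phase α (l * x + phaseTime α α))
      (√(cos (phase α (l * x + phaseTime α α)) ^ 2 + sin α ^ 2) * l) x := by
  have h : HasDerivAt (fun x => l * x + phaseTime α α) l x := by
    simpa using ((hasDerivAt_id x).const_mul l).add_const (phaseTime α α)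
  exact (hasDerivAt_phase hα _).comp x h

theorem hasDerivAt_cnWave (hα : sin α ≠ 0) (l x : ℝ) :
    HasDerivAt (cnWave α l) (cnWaveDeriv α l x) x := by
  refine ((hasDerivAt_phase_affine hα l x).cos.const_mul (√2 * l)).congr_deriv ?_
  rw [cnWaveDeriv]
  ring

theorem hasDerivAt_cnWaveDeriv (hα : sin α ≠ 0) (l x : ℝ) :
    HasDerivAt (cnWaveDeriv α l)
      ((l * cos α) ^ 2 * cnWave α l x - cnWave α l x ^ 3) x := by
  have hθ := hasDerivAt_phase_affine hα l x
  have hpos := cos_sq_add_sin_sq_pos hα (phase α (l * x + phaseTime α α))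
  refine ((hθ.sin.mul (((hθ.cos.pow 2).add_const (sin α ^ 2)).sqrt hpos.ne')).const_mul
    (-(√2 * l ^ 2))).congr_deriv ?_
  simp only [cnWave, Pi.pow_apply]
  set θ := phase α (l * x + phaseTime α α)
  set w := √(cos θ ^ 2 + sin α ^ 2)
  have hw : 0 < w := sqrt_pos.2 hpos
  have hw2 : w ^ 2 = cos θ ^ 2 + sin α ^ 2 := sq_sqrt hpos.le
  have h2 : √2 ^ 2 = 2 := sq_sqrt (by norm_num)
  have hs : sin α ^ 2 = 1 - cos α ^ 2 := sin_sq α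
  have hsθ : sin θ ^ 2 = 1 - cos θ ^ 2 := sin_sq θ
  field_simp
  rw [hw2, hs, hsθ, h2]
  ring

theorem phase_start (hα : sin α ≠ 0) (l : ℝ) : phase α (l * 0 + phaseTime α α) = α := by
  rw [mul_zero, zero_add, phase_phaseTime hα]

theorem cnWave_zero (hα : sin α ≠ 0) (l : ℝ) : cnWave α l 0 = √2 * l * cos α := by
  rw [cnWave, phase_start hα]

theorem cnWaveDeriv_zero (hα : sin α ≠ 0) (l : ℝ) :
    cnWaveDeriv α l 0 = -(√2 * l ^ 2) * sin α := by
  rw [cnWaveDeriv, phase_start hα, cos_sq_add_sin_sq, sqrt_one, mul_one]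

theorem exists_of_cnWave_periodic (hα : sin α ≠ 0) {l L : ℝ} (hl : l ≠ 0)
    (h : Function.Periodic (cnWave α l) L) : ∃ n : ℤ, l * L = 2 * n * phaseTime α π := by
  have h0 : cnWave α l L = cnWave α l 0 := by simpa using h 0
  have h1 : cnWaveDeriv α l L = cnWaveDeriv α l 0 := by
    have e : (fun x => cnWave α l (x + L)) = cnWave α l := funext h
    have := deriv_comp_add_const (cnWave α l) L 0
    rw [e, zero_add, (hasDerivAt_cnWave hα l _).deriv, (hasDerivAt_cnWave hα l _).deriv] at this
    exact this.symm
  rw [cnWave_zero hα, cnWave, mul_right_inj' (by positivity)] at h0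
  rw [cnWaveDeriv_zero hα, cnWaveDeriv, mul_right_inj' (by simpa using hl), h0,
    cos_sq_add_sin_sq, sqrt_one, mul_one] at h1
  obtain ⟨n, hn⟩ := Angle.angle_eq_iff_two_pi_dvd_sub.1 (Angle.cos_sin_inj h0 h1)
  refine ⟨n, ?_⟩
  have hθ : phase α (l * L + phaseTime α α) = α + ((2 * n : ℤ) : ℝ) * π := by
    push_cast; linarith
  have := congrArg (phaseTime α) hθ
  rw [phaseTime_phase hα, phaseTime_add_int_mul_pi hα] at this
  push_cast at this
  linarith

theorem exists_of_cnWave_sq_eq (hα : sin α ≠ 0) {l x : ℝ} (hl : l ≠ 0)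
    (h : cnWave α l x ^ 2 = cnWave α l 0 ^ 2) :
    ∃ k : ℤ, l * x = k * phaseTime α π ∨ l * x = k * phaseTime α π - 2 * phaseTime α α := by
  rw [cnWave_zero hα, cnWave, mul_pow, mul_pow (√2 * l),
    mul_right_inj' (by positivity)] at h
  set θ := phase α (l * x + phaseTime α α) with hθ
  have hT : phaseTime α θ = l * x + phaseTime α α := phaseTime_phase hα _
  have hcos : cos (2 * α) = cos (2 * θ) := by rw [cos_two_mul, cos_two_mul, h]
  obtain ⟨k, hk | hk⟩ := cos_eq_cos_iff.1 hcos
  · refine ⟨k, Or.inl ?_⟩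
    rw [show θ = α + k * π by linarith, phaseTime_add_int_mul_pi hα] at hT
    linarith
  · refine ⟨k, Or.inr ?_⟩
    rw [show θ = -α + k * π by linarith, phaseTime_add_int_mul_pi hα, phaseTime_neg] at hT
    linarith

end Wave

/-- The solution starting at `√2 s` with zero velocity is the soliton. -/
theorem eq_soliton {s : ℝ} {u p : ℝ → ℝ} (hu : ∀ x, HasDerivAt u (p x) x)
    (hp : ∀ x, HasDerivAt p (s ^ 2 * u x - u x ^ 3) x) (h0 : u 0 = √2 * s) (h1 : p 0 = 0) :
    u = fun x => √2 * s * (cosh (s * x))⁻¹ := by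
  have hlin : ∀ x, HasDerivAt (fun x => s * x) s x := fun x => by
    simpa using (hasDerivAt_id x).const_mul s
  refine duffing_unique (ω := -s ^ 2)
    (q := fun x => -(√2 * s ^ 2) * (sinh (s * x) / cosh (s * x) ^ 2)) hu
    (fun x => by simpa using hp x) (fun x => ?_) (fun x => ?_) (by simp [h0]) (by simp [h1])
  · refine (((hlin x).cosh.inv (cosh_pos _).ne').const_mul (√2 * s)).congr_deriv ?_
    ring
  · have hc := (cosh_pos (s * x)).ne'
    refine (((hlin x).sinh.div ((hlin x).cosh.pow 2) (pow_ne_zero 2 hc)).const_mul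
      (-(√2 * s ^ 2))).congr_deriv ?_
    have hs : sinh (s * x) ^ 2 = cosh (s * x) ^ 2 - 1 := sinh_sq _
    have h2 : √2 ^ 2 = 2 := sq_sqrt (by norm_num)
    simp only [Pi.pow_apply]
    field_simp
    rw [hs, h2]
    push_cast
    ring

theorem exists_eq_cnWave {ω L : ℝ} {u p : ℝ → ℝ} (hω : ω < 0) (hL : 0 < L)
    (hu : ∀ x, HasDerivAt u (p x) x) (hp : ∀ x, HasDerivAt p (-ω * u x - u x ^ 3) x)
    (hper : Function.Periodic u L) (h0 : u 0 = √(2 * |ω|)) :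
    ∃ l α : ℝ, 0 < l ∧ α ∈ Ioo (-(π / 2)) (π / 2) ∧ α ≠ 0 ∧ ω = -(l * cos α) ^ 2 ∧
      u = cnWave α l := by
  rw [abs_of_neg hω] at h0
  have ha : 0 < -ω := neg_pos.2 hω
  by_cases hp0 : p 0 = 0
  · exfalso
    have hs2 : √(-ω) ^ 2 = -ω := sq_sqrt ha.le
    have hs : 0 < √(-ω) := sqrt_pos.2 ha
    have h := eq_soliton (s := √(-ω)) hu (by simpa only [hs2] using hp)
      (by rw [h0, sqrt_mul zero_le_two]) hp0
    have hLu : u L = u 0 := by simpa using hper 0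
    rw [h] at hLu
    have : 1 < cosh (√(-ω) * L) := one_lt_cosh.2 (by positivity)
    simp only [mul_zero, cosh_zero] at hLu
    rw [mul_right_inj' (by positivity), inv_inj] at hLu
    linarith
  set q := p 0 with hq
  set r := √(ω ^ 2 + 2 * q ^ 2) with hr
  have hr2 : r ^ 2 = ω ^ 2 + 2 * q ^ 2 := sq_sqrt (by positivity)
  have hrpos : 0 < r := sqrt_pos.2 (by positivity)
  set A := -ω + r with hA
  have hApos : 0 < A := by positivity
  have hAA : A ^ 2 = -2 * ω * A + 2 * q ^ 2 := by rw [hA]; linear_combination hr2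
  have h2 : √2 ^ 2 = 2 := sq_sqrt (by norm_num)
  set t := -(√2 * q / A) with ht
  have ht2 : t ^ 2 = 1 - -2 * ω / A := by
    rw [ht]; field_simp; rw [h2]; linarith
  have hA2 : 0 < -2 * ω / A := div_pos (by linarith) hApos
  have htlt : t ^ 2 < 1 := by linarith
  obtain ⟨t1, t2⟩ := (sq_lt_one_iff_abs_lt_one t).1 htlt |> abs_lt.1
  have ht0 : t ≠ 0 := by
    rw [ht]; simp [hp0, hApos.ne']
  have hsin : sin (arcsin t) = t := sin_arcsin t1.le t2.le
  have hcos : cos (arcsin t) ^ 2 = -2 * ω / A := by rw [cos_sq', hsin, ht2]; ring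
  have hmem : arcsin t ∈ Ioo (-(π / 2)) (π / 2) :=
    ⟨neg_pi_div_two_lt_arcsin.2 t1, arcsin_lt_pi_div_two.2 t2⟩
  have hcpos : 0 < cos (arcsin t) := cos_pos_of_mem_Ioo hmem
  have hs0 : sin (arcsin t) ≠ 0 := by rwa [hsin]
  set α := arcsin t with hα
  have hl2 : √(A / 2) ^ 2 = A / 2 := sq_sqrt (by positivity)
  set l := √(A / 2) with hl
  have hlpos : 0 < l := sqrt_pos.2 (by positivity)
  have hω' : ω = -(l * cos α) ^ 2 := by
    rw [mul_pow, hl2, hcos]; field_simp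
  refine ⟨l, α, hlpos, hmem, fun h => hs0 (by rw [h, sin_zero]), hω', ?_⟩
  refine duffing_unique hu hp (hasDerivAt_cnWave hs0 l) (fun x => ?_) ?_ ?_
  · exact (hasDerivAt_cnWaveDeriv hs0 l x).congr_deriv (by rw [hω']; ring)
  · rw [cnWave_zero hs0, h0, hω', neg_neg, sqrt_mul zero_le_two, sqrt_sq (by positivity), mul_assoc]
  · rw [cnWaveDeriv_zero hs0, hl2, hsin, ← hq, ht]
    field_simp
    exact h2.symm

/-- for irrational ratio L₁/L, the set of solution pairs (ω, u) of
problem (P₊) or (P₋) is countable. -/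
theorem stmt_0 (L₁ L : ℝ) (hL₁ : 0 < L₁) (hL : L₁ ≤ L / 2)
    (hirr : Irrational (L₁ / L)) (ε : ℝ) (hε : ε = 1 ∨ ε = -1) :
    Set.Countable {p : ℝ × (ℝ → ℝ) |
      p.1 < 0 ∧ ContDiff ℝ 2 p.2 ∧ Function.Periodic p.2 L ∧
      (∀ x : ℝ, -(deriv (deriv p.2) x) - (p.2 x)^3 = p.1 * p.2 x) ∧
      p.2 0 = Real.sqrt (2 * |p.1|) ∧ p.2 L₁ = ε * Real.sqrt (2 * |p.1|)} := by
  have hLpos : 0 < L := by linarith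
  let R : ℤ × ℤ → Set (ℝ × (ℝ → ℝ)) := fun m => {p | ∃ l α : ℝ, 0 < l ∧
    α ∈ Ioo (-(π / 2)) (π / 2) ∧ α ≠ 0 ∧ p = (-(l * cos α) ^ 2, cnWave α l) ∧
    l * L = 2 * m.1 * phaseTime α π ∧ l * L₁ = m.2 * phaseTime α π - 2 * phaseTime α α}
  have hR : ∀ m, (R m).Subsingleton := by
    rintro ⟨n, k⟩ _ ⟨l, α, hl, hα, hα0, rfl, h1, h2⟩ _ ⟨l', β, hl', hβ, hβ0, rfl, h3, h4⟩
    have hαβ : α = β := by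
      refine phaseTime_ratio_injective hα hα0 hβ hβ0 (mul_left_cancel₀ hLpos.ne' ?_)
      simp only at h1 h2 h3 h4
      linear_combination (phaseTime α π * L₁ / 2) * h3 - (phaseTime α π * L / 2) * h4 +
        (phaseTime β π * L / 2) * h2 - (phaseTime β π * L₁ / 2) * h1
    subst hαβ
    have hll : l = l' := mul_right_cancel₀ hLpos.ne' (h1.trans h3.symm)
    rw [hll]
  refine (countable_iUnion fun m => (hR m).countable).mono ?_
  rintro ⟨ω, u⟩ ⟨hω, hu, hper, heq, h0, h1⟩
  simp only at hω hu hper heq h0 h1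
  have hd : ∀ x, HasDerivAt u (deriv u x) x := fun x =>
    (hu.differentiable two_ne_zero x).hasDerivAt
  have hdd : ∀ x, HasDerivAt (deriv u) (-ω * u x - u x ^ 3) x := fun x => by
    have := (((contDiff_succ_iff_deriv (n := 1)).1 hu).2.2.differentiable one_ne_zero x).hasDerivAt
    exact this.congr_deriv (by linarith [heq x])
  obtain ⟨l, α, hl, hα, hα0, hωl, rfl⟩ := exists_eq_cnWave hω hLpos hd hdd hper h0
  have hs := sin_ne_zero_of_mem_Ioo hα hα0
  have hsq : cnWave α l L₁ ^ 2 = cnWave α l 0 ^ 2 := by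
    rw [h0, h1]
    rcases hε with rfl | rfl <;> ring
  obtain ⟨n, hn⟩ := exists_of_cnWave_periodic hs hl.ne' hper
  obtain ⟨k, hk | hk⟩ := exists_of_cnWave_sq_eq hs hl.ne' hsq
  · exfalso
    have hπ := phaseTime_pi_pos hs
    have hn0 : (n : ℝ) ≠ 0 := by
      rintro h
      rw [h] at hn
      have := mul_pos hl hLpos
      linarith
    refine hirr ⟨(k : ℚ) / (2 * n), ?_⟩
    push_cast
    rw [div_eq_div_iff (by positivity) hLpos.ne']
    refine mul_left_cancel₀ (mul_pos hl hπ).ne' ?_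
    linear_combination (k * phaseTime α π) * hn - (2 * n * phaseTime α π) * hk
  · exact mem_iUnion.2 ⟨(n, k), l, α, hl, hα, hα0, by rw [hωl], hn, hk⟩
end

section
/- Let L₁, L be real numbers with 0 < L₁ ≤ L/2 and suppose L₁/L = p/q is rational with p, q coprime positive integers. Then for every ω < 0 there exists a twice continuously differentiable L-periodic function u : ℝ → ℝ with −u''(x) − u(x)³ = ω·u(x) for all x ∈ ℝ and u(0) = u(L₁) = √(2|ω|). If moreover q is even, then for every ω < 0 there also exists a twice continuously differentiable L-periodic function u : ℝ → ℝ with −u''(x) − u(x)³ = ω·u(x) for all x ∈ ℝ, u(0) = √(2|ω|) and u(L₁) = −√(2|ω|). -/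
open Real Filter Set

/-- If `g` is continuous, positive and `T`-periodic with `∫₀ᵀ 1/g = H`, then the autonomous equation
`φ' = g(φ)` has a surjective solution which gains `T` over each interval of length `H`. -/
lemma exists_surjective_solution_of_periodic {g : ℝ → ℝ} {T H : ℝ} (hg : Continuous g)
    (hpos : ∀ x, 0 < g x) (hper : Function.Periodic g T) (hT : 0 < T)
    (hH : ∫ x in (0 : ℝ)..T, (g x)⁻¹ = H) :
    ∃ φ : ℝ → ℝ, (∀ x, HasDerivAt φ (g (φ x)) x) ∧ (∀ x, φ (x + H) = φ x + T) ∧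
      Function.Surjective φ := by
  have hc : Continuous fun x => (g x)⁻¹ := hg.inv₀ fun x => (hpos x).ne'
  have hpos' : ∀ x, 0 < (g x)⁻¹ := fun x => inv_pos.2 (hpos x)
  have hper' : Function.Periodic (fun x => (g x)⁻¹) T := fun x => by simp only [hper x]
  set F : ℝ → ℝ := fun x => ∫ t in (0 : ℝ)..x, (g t)⁻¹ with hF
  have hderiv : ∀ x, HasDerivAt F (g x)⁻¹ x := fun x =>
    intervalIntegral.integral_hasDerivAt_right (hc.intervalIntegrable _ _)
      hc.stronglyMeasurable.stronglyMeasurableAtFilter hc.continuousAt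
  have hmono : StrictMono F := strictMono_of_hasDerivAt_pos hderiv hpos'
  have hcont : Continuous F := continuous_iff_continuousAt.2 fun x => (hderiv x).continuousAt
  have hint : IntervalIntegrable (fun x => (g x)⁻¹) MeasureTheory.volume 0 T :=
    hc.intervalIntegrable _ _
  have hsurj : Function.Surjective F := hcont.surjective
    (hper'.tendsto_atTop_intervalIntegral_of_pos' hint hpos' hT)
    (hper'.tendsto_atBot_intervalIntegral_of_pos' hint hpos' hT)
  have hshift : ∀ x, F (x + T) = F x + H := fun x => by
    rw [← hH, hF]
    simp only
    rw [← intervalIntegral.integral_add_adjacent_intervals (hc.intervalIntegrable 0 x)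
      (hc.intervalIntegrable x (x + T)), hper'.intervalIntegral_add_eq x 0, zero_add]
  let e := hmono.orderIsoOfSurjective F hsurj
  have hFe : ∀ x, F (e.symm x) = x := fun x => e.apply_symm_apply x
  refine ⟨e.symm, fun x => ?_, fun x => ?_, e.symm.surjective⟩
  · have h := (hderiv (e.symm x)).of_local_left_inverse e.symm.continuous.continuousAt
      (hpos' _).ne' (Eventually.of_forall hFe)
    simpa using h
  · apply hmono.injective
    rw [hshift, hFe, hFe]

/-- For every `m > 0` the equation `u'' = m u - u³` has solutions of every antiperiod `h > 0` that
pass through `√(2m)` at the origin. -/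
lemma exists_antiperiodic_solution {m h : ℝ} (hm : 0 < m) (hh : 0 < h) :
    ∃ u v : ℝ → ℝ, (∀ x, HasDerivAt u (v x) x) ∧ (∀ x, HasDerivAt v (m * u x - u x ^ 3) x) ∧
      Function.Antiperiodic u h ∧ u 0 = √(2 * m) := by
  -- In the phase `φ` of `u = A cos φ`, with `A² = 2 (a + m)` and `a = exp t`, the equation becomes
  -- `φ' = √(a + (a + m) cos² φ)`.
  let g : ℝ → ℝ → ℝ := fun t θ => √(exp t + (exp t + m) * cos θ ^ 2)
  have hg : ∀ t θ, 0 < exp t + (exp t + m) * cos θ ^ 2 := fun t θ => by positivity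
  have hgpos : ∀ t θ, 0 < g t θ := fun t θ => sqrt_pos.2 (hg t θ)
  let H : ℝ → ℝ := fun t => ∫ θ in (0 : ℝ)..π, (g t θ)⁻¹
  have hHcont : Continuous H := by
    apply intervalIntegral.continuous_parametric_intervalIntegral_of_continuous'
    exact Continuous.inv₀ (by fun_prop) fun x => (hgpos x.1 x.2).ne'
  have hHpos : 0 < H 0 := by
    refine intervalIntegral.intervalIntegral_pos_of_pos (Continuous.intervalIntegrable ?_ _ _)
      (fun x => inv_pos.2 (hgpos 0 x)) pi_pos
    exact Continuous.inv₀ (by fun_prop) fun x => (hgpos 0 x).ne'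
  have hHle : ∀ t, H t ≤ (√(exp t))⁻¹ * π := fun t => by
    have hle := intervalIntegral.norm_integral_le_of_norm_le_const (a := 0) (b := π)
      (f := fun θ => (g t θ)⁻¹) (C := (√(exp t))⁻¹) fun x _ => by
        rw [norm_of_nonneg (inv_pos.2 (hgpos t x)).le]
        have : √(exp t) ≤ g t x := sqrt_le_sqrt (le_add_of_nonneg_right (by positivity))
        gcongr
    rw [sub_zero, abs_of_pos pi_pos] at hle
    exact (le_abs_self _).trans hle
  have hHlim : Tendsto (fun t => (√(exp t))⁻¹ * π) atTop (nhds 0) := by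
    simpa using ((tendsto_sqrt_atTop.comp tendsto_exp_atTop).inv_tendsto_atTop).mul_const π
  -- An odd fraction of `h` is small enough to be a value of `H`.
  obtain ⟨n, hn⟩ := exists_nat_gt (h / H 0)
  let τ : ℝ := h / (2 * n + 1)
  have hτ : 0 < τ := by positivity
  have hτ0 : τ ≤ H 0 := by
    rw [div_lt_iff₀ hHpos] at hn
    rw [div_le_iff₀ (by positivity)]
    nlinarith [n.cast_nonneg (α := ℝ)]
  obtain ⟨b, hb⟩ := (hHlim.eventually_lt_const hτ).exists
  obtain ⟨t, ht⟩ := mem_range_of_exists_le_of_exists_ge hHcont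
    ⟨b, (hHle b).trans hb.le⟩ ⟨0, hτ0⟩
  obtain ⟨φ, hφ, hshift, hsurj⟩ := exists_surjective_solution_of_periodic (g := g t) (T := π)
    (by fun_prop) (hgpos t) (fun x => by simp only [g, cos_add_pi, neg_sq]) pi_pos ht
  set a := exp t
  have ha0 : 0 < a := exp_pos t
  set A := √(2 * (a + m))
  have hA0 : 0 < A := by positivity
  have hA2 : A ^ 2 = 2 * (a + m) := sq_sqrt (by positivity)
  obtain ⟨x₀, hx₀⟩ := hsurj (arccos (√(2 * m) / A))
  have hcos : cos (φ x₀) = √(2 * m) / A := by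
    rw [hx₀]
    refine cos_arccos ((neg_nonpos.2 zero_le_one).trans (by positivity)) ?_
    rw [div_le_one hA0]
    exact sqrt_le_sqrt (by linarith)
  have hφ' : ∀ x, HasDerivAt (fun x => φ (x + x₀)) (g t (φ (x + x₀))) x := fun x =>
    (hφ (x + x₀)).comp_add_const x x₀
  have hanti : Function.Antiperiodic (fun x => A * cos (φ (x + x₀))) τ := fun x => by
    simp only
    rw [add_right_comm, hshift, cos_add_pi, mul_neg]
  refine ⟨fun x => A * cos (φ (x + x₀)), fun x => A * (-sin (φ (x + x₀)) * g t (φ (x + x₀))),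
    fun x => (hφ' x).cos.const_mul A, fun x => ?_, ?_, ?_⟩
  · have hsq : g t (φ (x + x₀)) ^ 2 = a + (a + m) * cos (φ (x + x₀)) ^ 2 := sq_sqrt (hg t _).le
    have hd := (((hφ' x).sin.neg.mul (((((hφ' x).cos.pow 2).const_mul (a + m)).const_add a).sqrt
      (hg t _).ne')).const_mul A)
    refine hd.congr_deriv ?_
    have hs := sin_sq_add_cos_sq (φ (x + x₀))
    have hgp := (hgpos t (φ (x + x₀))).ne'
    change A * (-(cos (φ (x + x₀)) * g t (φ (x + x₀))) * g t (φ (x + x₀)) +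
      -sin (φ (x + x₀)) * (_ / (2 * g t (φ (x + x₀))))) =
      m * (A * cos (φ (x + x₀))) - (A * cos (φ (x + x₀))) ^ 3
    generalize g t (φ (x + x₀)) = G at *
    generalize cos (φ (x + x₀)) = c at *
    generalize sin (φ (x + x₀)) = s at *
    field_simp
    simp only [Nat.cast_ofNat]
    linear_combination (-2 * c) * hsq + 2 * c * (a + m) * hs + 2 * c ^ 3 * hA2
  · have hτh : (2 * n + 1) • τ = h := by
      simp only [nsmul_eq_mul, τ]
      push_cast
      field_simp
    exact hτh ▸ hanti.odd_nsmul_antiperiodic n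
  · simp only [zero_add, hcos]
    field_simp

/-- if L₁/L = p/q is rational (p, q coprime positive integers), then
problem (P₊) has a solution for every ω < 0, and if q is even so does (P₋). -/
theorem stmt_2 (L₁ L : ℝ) (hL₁ : 0 < L₁) (hL : L₁ ≤ L / 2)
    (p q : ℕ) (hp : 0 < p) (hq : 0 < q) (hpq : Nat.Coprime p q)
    (hrat : L₁ / L = (p : ℝ) / q) :
    (∀ ω : ℝ, ω < 0 → ∃ u : ℝ → ℝ, ContDiff ℝ 2 u ∧ Function.Periodic u L ∧
      (∀ x : ℝ, -(deriv (deriv u) x) - (u x)^3 = ω * u x) ∧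
      u 0 = Real.sqrt (2 * |ω|) ∧ u L₁ = Real.sqrt (2 * |ω|)) ∧
    (Even q → ∀ ω : ℝ, ω < 0 → ∃ u : ℝ → ℝ, ContDiff ℝ 2 u ∧ Function.Periodic u L ∧
      (∀ x : ℝ, -(deriv (deriv u) x) - (u x)^3 = ω * u x) ∧
      u 0 = Real.sqrt (2 * |ω|) ∧ u L₁ = -Real.sqrt (2 * |ω|)) := by
  have hL0 : 0 < L := by linarith
  have hq0 : (0 : ℝ) < q := by exact_mod_cast hq
  have hLL : L₁ = p * (L / q) := by
    field_simp at hrat ⊢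
    linarith
  have key : ∀ ω : ℝ, ω < 0 → ∀ h : ℝ, 0 < h → ∃ u : ℝ → ℝ, ContDiff ℝ 2 u ∧
      Function.Antiperiodic u h ∧ (∀ x : ℝ, -(deriv (deriv u) x) - (u x)^3 = ω * u x) ∧
      u 0 = Real.sqrt (2 * |ω|) := by
    intro ω hω h hh
    obtain ⟨u, v, hu, hv, hanti, h0⟩ := exists_antiperiodic_solution (abs_pos.2 hω.ne) hh
    have hdu : deriv u = v := funext fun x => (hu x).deriv
    have hdv : deriv v = fun x => |ω| * u x - u x ^ 3 := funext fun x => (hv x).deriv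
    have hu' : Differentiable ℝ u := fun x => (hu x).differentiableAt
    have hv' : Differentiable ℝ v := fun x => (hv x).differentiableAt
    have hcu : Continuous u := hu'.continuous
    refine ⟨u, ?_, hanti, fun x => ?_, h0⟩
    · have hv1 : ContDiff ℝ 1 v := contDiff_one_iff_deriv.2 ⟨hv', by rw [hdv]; fun_prop⟩
      rw [show (2 : WithTop ℕ∞) = 1 + 1 by norm_num, contDiff_succ_iff_deriv, hdu]
      exact ⟨hu', by simp, hv1⟩
    · rw [hdu, hdv, abs_of_neg hω]
      ring
  refine ⟨fun ω hω => ?_, fun hqe ω hω => ?_⟩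
  · obtain ⟨u, hu, hanti, hode, h0⟩ := key ω hω (L / (2 * q)) (by positivity)
    have hper : Function.Periodic u (L / q) := by
      have h2 : 2 * (L / (2 * q)) = L / q := by field_simp
      exact h2 ▸ hanti.periodic_two_mul
    refine ⟨u, hu, ?_, hode, h0, ?_⟩
    · have hqL : q * (L / q) = L := by field_simp
      exact hqL ▸ hper.nat_mul q
    · rw [hLL, hper.nat_mul_eq, h0]
  · obtain ⟨u, hu, hanti, hode, h0⟩ := key ω hω (L / q) (by positivity)
    refine ⟨u, hu, ?_, hode, h0, ?_⟩
    · obtain ⟨k, rfl⟩ := hqe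
      have hkL : (2 * k) • (L / ↑(k + k)) = L := by
        rw [← two_mul] at hq0 ⊢
        rw [nsmul_eq_mul]
        field_simp
      have := hanti.even_nsmul_periodic k
      rwa [hkL] at this
    · obtain ⟨k, rfl⟩ : Odd p := by
        rw [← Nat.not_even_iff_odd]
        exact fun hpe => absurd (Nat.dvd_gcd hpe.two_dvd hqe.two_dvd) (by simp [hpq.gcd_eq_one])
      have := hanti.odd_nsmul_antiperiodic k 0
      rw [zero_add, nsmul_eq_mul, ← hLL] at this
      rw [this, h0]
end

section
/- For every k ∈ (1/√2, 1), one has ∫_{√((2k²−1)/k²)}^{1} k·√(1−t²)/(1 − k²(1−t²))^{3/2} dt ≤ (√(1−k²)/k³)·(1 − √(2 − 1/k²)) ≤ 2. -/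
/-- for every k ∈ (1/√2, 1),
∫_{√((2k²−1)/k²)}^{1} k√(1−t²)/(1−k²(1−t²))^{3/2} dt
  ≤ (√(1−k²)/k³)(1 − √(2 − 1/k²)) ≤ 2. -/
theorem stmt_5 (k : ℝ) (hk : k ∈ Set.Ioo (1 / Real.sqrt 2) 1) :
    (∫ t in Real.sqrt ((2 * k^2 - 1) / k^2)..1,
        k * Real.sqrt (1 - t^2) / Real.sqrt (1 - k^2 * (1 - t^2)) ^ 3)
      ≤ Real.sqrt (1 - k^2) / k^3 * (1 - Real.sqrt (2 - 1 / k^2)) ∧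
    Real.sqrt (1 - k^2) / k^3 * (1 - Real.sqrt (2 - 1 / k^2)) ≤ 2 := by
  obtain ⟨hk₁, hk₂⟩ := hk
  have hk₀ : 0 < k := lt_trans (by positivity) hk₁
  have hsq : 1 / 2 < k ^ 2 := by
    have h := pow_lt_pow_left₀ hk₁ (by positivity) two_ne_zero
    rwa [div_pow, one_pow, Real.sq_sqrt zero_le_two] at h
  have hend : (2 * k ^ 2 - 1) / k ^ 2 = 2 - 1 / k ^ 2 := by field_simp
  have hend_nonneg : 0 ≤ 2 - 1 / k ^ 2 := by
    rw [← hend]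
    exact div_nonneg (by linarith) (by positivity)
  have hend_le : √(2 - 1 / k ^ 2) ≤ 1 := by
    rw [Real.sqrt_le_one, ← hend, div_le_one (by positivity)]
    nlinarith
  constructor
  · rw [hend]
    refine (le_abs_self _).trans ?_
    rw [← Real.norm_eq_abs, ← abs_of_nonneg (sub_nonneg.2 hend_le)]
    refine intervalIntegral.norm_integral_le_of_norm_le_const fun t ht => ?_
    rw [Set.uIoc_of_le hend_le] at ht
    have ht₂ : 2 * k ^ 2 - 1 ≤ k ^ 2 * t ^ 2 := by
      have h := pow_le_pow_left₀ (Real.sqrt_nonneg _) ht.1.le 2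
      rw [Real.sq_sqrt hend_nonneg, ← hend, div_le_iff₀ (by positivity)] at h
      linarith
    rw [Real.norm_of_nonneg (by positivity)]
    have hnum : k * √(1 - t ^ 2) ≤ √(1 - k ^ 2) := by
      rw [← Real.sqrt_sq hk₀.le, ← Real.sqrt_mul (sq_nonneg k), Real.sqrt_sq hk₀.le]
      exact Real.sqrt_le_sqrt (by linarith)
    have hden : k ≤ √(1 - k ^ 2 * (1 - t ^ 2)) := Real.le_sqrt_of_sq_le (by linarith)
    gcongr
  · have hcoef : √(1 - k ^ 2) / k ^ 3 ≤ 2 := by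
      rw [div_le_iff₀ (by positivity)]
      have h : √(1 - k ^ 2) ≤ k := Real.sqrt_le_iff.2 ⟨hk₀.le, by linarith⟩
      nlinarith
    calc √(1 - k ^ 2) / k ^ 3 * (1 - √(2 - 1 / k ^ 2))
        ≤ √(1 - k ^ 2) / k ^ 3 :=
          mul_le_of_le_one_right (by positivity) (sub_le_self 1 (Real.sqrt_nonneg _))
      _ ≤ 2 := hcoef
end
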